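/- For every n ≥ 1 the recurrence coefficient β_n satisfies (2n−1+α+β+γ)(2n+1+α+β+γ)β_n = [t r*_n − (t−1)r_n]² − (t−1)(2nt + γt + β)r_n + t[(t−1)(2n+γ) − α]r*_n + n(n+γ)(t² − t). -/

import Mathlib

open MeasureTheory Real

/-- The generalized Jacobi weight `w(x;t) = (x-t)^γ x^α (1-x)^β`. -/
noncomputable def genJacobiWeight (α β γ t x : ℝ) : ℝ :=
  (x - t) ^ γ * x ^ α * (1 - x) ^ β

open Polynomial

section MomentFunctional

variable {L : ℝ[X] →ₗ[ℝ] ℝ} {P : ℕ → ℝ[X]} {h : ℕ → ℝ}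

/-- A monic orthogonal polynomial annihilates every polynomial of smaller degree. -/
lemma orthogonal_of_degree_lt
    (hmonic : ∀ n, (P n).Monic ∧ (P n).natDegree = n)
    (horth : ∀ m n, L (P m * P n) = if m = n then h n else 0)
    (n : ℕ) (Q : ℝ[X]) (hQ : Q.degree < n) : L (Q * P n) = 0 := by
  suffices H : ∀ m : ℕ, m ≤ n → ∀ Q : ℝ[X], Q.degree < m → L (Q * P n) = 0 from
    H n le_rfl Q hQ
  intro m
  induction m with
  | zero =>
    intro _ Q hQ
    have : Q = 0 := by simpa using hQ
    simp [this]
  | succ m ih =>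
    intro hm Q hQ
    have hlow : (Q - C (Q.coeff m) * P m).degree < m := by
      rw [degree_lt_iff_coeff_zero]
      intro k hk
      rcases hk.eq_or_lt with rfl | hk
      · have : (P m).coeff m = 1 := by
          simpa [(hmonic m).2] using (hmonic m).1.coeff_natDegree
        simp [this]
      · have h₁ : Q.coeff k = 0 := (degree_lt_iff_coeff_zero Q (m + 1)).1 hQ k hk
        have h₂ : (P m).coeff k = 0 :=
          coeff_eq_zero_of_natDegree_lt (by rwa [(hmonic m).2])
        simp [h₁, h₂]
    have h₁ := ih (by omega) _ hlow
    have h₂ : L (P m * P n) = 0 := by rw [horth, if_neg (by omega)]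
    rw [sub_mul, map_sub, mul_assoc, ← smul_eq_C_mul, map_smul, h₂] at h₁
    simpa using h₁

/-- Pairing with a monic orthogonal polynomial extracts the coefficient of top degree. -/
lemma pairing_eq_coeff_mul
    (hmonic : ∀ n, (P n).Monic ∧ (P n).natDegree = n)
    (horth : ∀ m n, L (P m * P n) = if m = n then h n else 0)
    (n : ℕ) (Q : ℝ[X]) (hQ : Q.natDegree ≤ n) : L (Q * P n) = Q.coeff n * h n := by
  have hlow : (Q - C (Q.coeff n) * P n).degree < n := by
    rw [degree_lt_iff_coeff_zero]
    intro k hk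
    rcases hk.eq_or_lt with rfl | hk
    · have : (P n).coeff n = 1 := by
        simpa [(hmonic n).2] using (hmonic n).1.coeff_natDegree
      simp [this]
    · have h₁ : Q.coeff k = 0 := coeff_eq_zero_of_natDegree_lt (by omega)
      have h₂ : (P n).coeff k = 0 :=
        coeff_eq_zero_of_natDegree_lt (by rwa [(hmonic n).2])
      simp [h₁, h₂]
  have h₁ := orthogonal_of_degree_lt hmonic horth n _ hlow
  have h₂ : L (P n * P n) = h n := by rw [horth, if_pos rfl]
  rw [sub_mul, map_sub, mul_assoc, ← smul_eq_C_mul, map_smul, h₂, smul_eq_mul] at h₁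
  linarith

/-- If `M` is the functional `L` divided by `X - c`, then
`M (Q * R) = Q(c) M(R) + L ((Q - Q(c)) / (X - c) * R)`. -/
lemma divided_functional_mul {M : ℝ[X] →ₗ[ℝ] ℝ} {c : ℝ}
    (hM : ∀ Q, M ((X - C c) * Q) = L Q) (Q R : ℝ[X]) :
    M (Q * R) = Q.eval c * M R + L (Q /ₘ (X - C c) * R) := by
  conv_lhs => rw [← modByMonic_add_div Q (X - C c), modByMonic_X_sub_C_eq_C_eval]
  rw [add_mul, map_add, mul_assoc, hM, ← smul_eq_C_mul, map_smul, smul_eq_mul]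

/-- The Casorati-type identity for a functional divided by `X - c`. -/
lemma divided_functional_casorati {M : ℝ[X] →ₗ[ℝ] ℝ} {c : ℝ}
    (hmonic : ∀ n, (P n).Monic ∧ (P n).natDegree = n)
    (horth : ∀ m n, L (P m * P n) = if m = n then h n else 0)
    (hM : ∀ Q, M ((X - C c) * Q) = L Q) (k : ℕ) :
    M (P k * P (k + 1)) * (M (P k * P (k + 1)) - h k)
      = M (P (k + 1) * P (k + 1)) * M (P k * P k) := by
  have hdiv : ∀ n, (P n /ₘ (X - C c)).natDegree = n - 1 := fun n => by
    rw [natDegree_divByMonic _ (monic_X_sub_C c), natDegree_X_sub_C, (hmonic n).2]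
  have hlead : (P (k + 1) /ₘ (X - C c)).coeff k = 1 := by
    have h₁ := leadingCoeff_divByMonic_X_sub_C (P (k + 1))
      (by rw [degree_eq_natDegree (hmonic _).1.ne_zero, (hmonic _).2]; exact_mod_cast k.succ_ne_zero) c
    rw [(hmonic _).1.leadingCoeff, leadingCoeff, hdiv] at h₁
    simpa using h₁
  have hsame : ∀ n, M (P n * P n) = (P n).eval c * M (P n) := fun n => by
    rw [divided_functional_mul hM, orthogonal_of_degree_lt hmonic horth, add_zero]
    have h₁ := degree_divByMonic_lt (P n) (X - C c) (hmonic n).1.ne_zero (by simp)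
    rwa [degree_eq_natDegree (hmonic n).1.ne_zero, (hmonic n).2] at h₁
  have hup : M (P k * P (k + 1)) = (P k).eval c * M (P (k + 1)) := by
    rw [divided_functional_mul hM, orthogonal_of_degree_lt hmonic horth, add_zero]
    refine degree_le_natDegree.trans_lt ?_
    rw [hdiv]
    exact_mod_cast (by omega : k - 1 < k + 1)
  have hdown : M (P k * P (k + 1)) = (P (k + 1)).eval c * M (P k) + h k := by
    rw [mul_comm, divided_functional_mul hM,
      pairing_eq_coeff_mul hmonic horth k _ (by rw [hdiv]; omega), hlead, one_mul]
  rw [hsame, hsame]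
  calc _ = (P k).eval c * M (P (k + 1)) * ((P (k + 1)).eval c * M (P k)) := by
        rw [← hup]; nth_rewrite 2 [hdown]; ring
    _ = _ := by ring

variable {M₀ M₁ Mt : ℝ[X] →ₗ[ℝ] ℝ} {α β γ t : ℝ}

/-- Pearson's equation tested on `P k * P (k + 1)`. -/
lemma pearson_consecutive
    (hmonic : ∀ n, (P n).Monic ∧ (P n).natDegree = n)
    (horth : ∀ m n, L (P m * P n) = if m = n then h n else 0)
    (hpearson : ∀ Q, L (derivative Q) + γ * Mt Q + α * M₀ Q + β * M₁ Q = 0) (k : ℕ) :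
    (k + 1) * h k + γ * Mt (P k * P (k + 1)) + α * M₀ (P k * P (k + 1))
      + β * M₁ (P k * P (k + 1)) = 0 := by
  have h₁ := hpearson (P k * P (k + 1))
  have h₂ : L (derivative (P k) * P (k + 1)) = 0 := by
    refine orthogonal_of_degree_lt hmonic horth _ _ (degree_le_natDegree.trans_lt ?_)
    have := natDegree_derivative_le (P k)
    rw [(hmonic k).2] at this
    exact_mod_cast (by omega : (derivative (P k)).natDegree < k + 1)
  have h₃ : L (derivative (P (k + 1)) * P k) = (k + 1) * h k := by
    have := natDegree_derivative_le (P (k + 1))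
    rw [(hmonic _).2] at this
    have hc : (P (k + 1)).coeff (k + 1) = 1 := by
      simpa [(hmonic _).2] using (hmonic (k + 1)).1.coeff_natDegree
    rw [pairing_eq_coeff_mul hmonic horth k _ (by omega), coeff_derivative, hc, one_mul]
  rw [derivative_mul, map_add, h₂, mul_comm (P k) (derivative _), h₃] at h₁
  linarith

/-- Pearson's equation tested on `P n ^ 2`. -/
lemma pearson_square
    (hmonic : ∀ n, (P n).Monic ∧ (P n).natDegree = n)
    (horth : ∀ m n, L (P m * P n) = if m = n then h n else 0)
    (hpearson : ∀ Q, L (derivative Q) + γ * Mt Q + α * M₀ Q + β * M₁ Q = 0) (n : ℕ) :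
    γ * Mt (P n * P n) + α * M₀ (P n * P n) + β * M₁ (P n * P n) = 0 := by
  have h₁ := hpearson (P n * P n)
  have h₂ : L (derivative (P n) * P n) = 0 := by
    refine orthogonal_of_degree_lt hmonic horth _ _ ?_
    have := degree_derivative_lt (hmonic n).1.ne_zero
    rwa [degree_eq_natDegree (hmonic n).1.ne_zero, (hmonic n).2] at this
  rw [derivative_mul, map_add, mul_comm (P n) (derivative _), h₂] at h₁
  linarith

/-- Pearson's equation tested on `X * P n ^ 2`. -/
lemma pearson_X_mul_square
    (hmonic : ∀ n, (P n).Monic ∧ (P n).natDegree = n)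
    (horth : ∀ m n, L (P m * P n) = if m = n then h n else 0)
    (hM₀ : ∀ Q, M₀ ((X - C 0) * Q) = L Q) (hM₁ : ∀ Q, M₁ ((X - C 1) * Q) = L Q)
    (hMt : ∀ Q, Mt ((X - C t) * Q) = L Q)
    (hpearson : ∀ Q, L (derivative Q) + γ * Mt Q + α * M₀ Q + β * M₁ Q = 0) (n : ℕ) :
    (2 * n + 1 + α + β + γ) * h n + t * (γ * Mt (P n * P n)) + β * M₁ (P n * P n) = 0 := by
  have h₁ := hpearson (X * (P n * P n))
  have hX : ∀ {M : ℝ[X] →ₗ[ℝ] ℝ} {c : ℝ}, (∀ Q, M ((X - C c) * Q) = L Q) →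
      M (X * (P n * P n)) = h n + c * M (P n * P n) := fun {M c} hM => by
    have h₂ := hM (P n * P n)
    rw [horth, if_pos rfl, sub_mul, map_sub, ← smul_eq_C_mul, map_smul, smul_eq_mul] at h₂
    linarith
  have h₂ : L (derivative (X * (P n * P n))) = (2 * n + 1) * h n := by
    have hd : derivative (X * (P n * P n))
        = P n * P n + (2 : ℝ) • (X * derivative (P n) * P n) := by
      simp only [derivative_mul, derivative_X, smul_eq_C_mul, map_ofNat]; ring
    have h₃ : L (X * derivative (P n) * P n) = n * h n := by
      rcases n with _ | n
      · have : P 0 = 1 := (hmonic 0).1.natDegree_eq_zero.1 (hmonic 0).2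
        simp [this]
      have h₄ : (X * derivative (P (n + 1))).natDegree ≤ n + 1 := by
        have h₅ := natDegree_derivative_le (P (n + 1))
        rw [(hmonic _).2] at h₅
        have h₆ := natDegree_mul_le (p := X) (q := derivative (P (n + 1)))
        rw [natDegree_X] at h₆
        omega
      have hc : (P (n + 1)).coeff (n + 1) = 1 := by
        simpa [(hmonic _).2] using (hmonic (n + 1)).1.coeff_natDegree
      rw [pairing_eq_coeff_mul hmonic horth _ _ h₄, coeff_X_mul, coeff_derivative, hc]
      push_cast; ring
    rw [hd, map_add, map_smul, h₃, horth, if_pos rfl, smul_eq_mul]; ring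
  rw [h₂, hX hMt, hX hM₀, hX hM₁] at h₁
  linarith

/-- The recurrence coefficient is a quotient of consecutive norms. -/
lemma recurrence_coeff_mul_norm
    (hmonic : ∀ n, (P n).Monic ∧ (P n).natDegree = n)
    (horth : ∀ m n, L (P m * P n) = if m = n then h n else 0) {a b : ℝ} {k : ℕ}
    (hrec : X * P (k + 1) = P (k + 2) + C a * P (k + 1) + C b * P k) :
    b * h k = h (k + 1) := by
  have h₁ : L (X * P k * P (k + 1)) = h (k + 1) := by
    have h₂ : (X * P k).natDegree ≤ k + 1 := by
      have := natDegree_mul_le (p := X) (q := P k)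
      rw [natDegree_X, (hmonic k).2] at this
      omega
    have hc : (P k).coeff k = 1 := by
      simpa [(hmonic _).2] using (hmonic k).1.coeff_natDegree
    rw [pairing_eq_coeff_mul hmonic horth _ _ h₂, coeff_X_mul, hc, one_mul]
  rw [show X * P k * P (k + 1) = P (k + 2) * P k + a • (P (k + 1) * P k) + b • (P k * P k) by
    simp only [smul_eq_C_mul]; linear_combination P k * hrec] at h₁
  simpa [horth] using h₁

/-- The formula for the recurrence coefficient of a functional satisfying the Pearson equation
of the generalized Jacobi weight. -/
lemma recurrence_coeff_of_pearson
    (hmonic : ∀ n, (P n).Monic ∧ (P n).natDegree = n)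
    (horth : ∀ m n, L (P m * P n) = if m = n then h n else 0) (hpos : ∀ n, 0 < h n)
    (hM₀ : ∀ Q, M₀ ((X - C 0) * Q) = L Q) (hM₁ : ∀ Q, M₁ ((X - C 1) * Q) = L Q)
    (hMt : ∀ Q, Mt ((X - C t) * Q) = L Q)
    (hpearson : ∀ Q, L (derivative Q) + γ * Mt Q + α * M₀ Q + β * M₁ Q = 0)
    {a b r rs : ℝ} {k : ℕ}
    (hrec : X * P (k + 1) = P (k + 2) + C a * P (k + 1) + C b * P k)
    (hr : r = -(β / h k * M₁ (P k * P (k + 1)))) (hrs : rs = α / h k * M₀ (P k * P (k + 1))) :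
    (2 * (k + 1) - 1 + α + β + γ) * (2 * (k + 1) + 1 + α + β + γ) * b
        = (t * rs - (t - 1) * r) ^ 2
          - (t - 1) * (2 * (k + 1) * t + γ * t + β) * r
          + t * ((t - 1) * (2 * (k + 1) + γ) - α) * rs
          + (k + 1) * (k + 1 + γ) * (t ^ 2 - t) := by
  have hne : ∀ n, h n ≠ 0 := fun n => (hpos n).ne'
  have hk := hne k
  have hk' := hne (k + 1)
  have hb : b = h (k + 1) / h k :=
    eq_div_of_mul_eq hk (recurrence_coeff_mul_norm hmonic horth hrec)
  obtain ⟨q, hq⟩ : ∃ q, q = γ / h k * Mt (P k * P (k + 1)) := ⟨_, rfl⟩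
  have hnonlin : ∀ {M : ℝ[X] →ₗ[ℝ] ℝ} {c : ℝ}, (∀ Q, M ((X - C c) * Q) = L Q) → ∀ δ s : ℝ,
      s = δ / h k * M (P k * P (k + 1)) → s * (s - δ) = b *
        (δ * M (P (k + 1) * P (k + 1)) / h (k + 1)) * (δ * M (P k * P k) / h k) :=
    fun {M c} hM δ s hs => by
      have h₁ := divided_functional_casorati hmonic horth hM k
      rw [hs, hb]
      field_simp
      linear_combination δ ^ 2 * h₁
  have e₀ := hnonlin hM₀ α rs hrs
  have e₁ := hnonlin hM₁ β (-r) (by rw [hr, neg_neg])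
  have et := hnonlin hMt γ q hq
  have hlin : q + rs - r = -(k + 1) := by
    have h₁ := pearson_consecutive hmonic horth hpearson k
    rw [hq, hrs, hr]
    field_simp
    linear_combination h₁
  obtain ⟨T, hT⟩ : ∃ T : ℕ → ℝ, ∀ n, T n = γ * Mt (P n * P n) / h n := ⟨_, fun _ => rfl⟩
  have hM₁T : ∀ n : ℕ, β * M₁ (P n * P n) / h n = -(2 * n + 1 + α + β + γ + t * T n) := by
    intro n
    have h₁ := pearson_X_mul_square hmonic horth hM₀ hM₁ hMt hpearson n
    have h₂ := hne n
    rw [hT]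
    field_simp
    linear_combination h₁
  have hM₀T : ∀ n : ℕ, α * M₀ (P n * P n) / h n
      = 2 * n + 1 + α + β + γ + (t - 1) * T n := by
    intro n
    have h₁ := pearson_X_mul_square hmonic horth hM₀ hM₁ hMt hpearson n
    have h₃ := pearson_square hmonic horth hpearson n
    have h₂ := hne n
    rw [hT]
    field_simp
    linear_combination h₃ - h₁
  rw [← hT, ← hT] at et
  rw [hM₁T, hM₁T] at e₁
  rw [hM₀T, hM₀T] at e₀
  push_cast at e₀ e₁
  obtain rfl : q = r - rs - (k + 1) := by linear_combination hlin
  linear_combination (t - 1) * e₁ - t * e₀ - t * (t - 1) * et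

end MomentFunctional

section Weight

/-- Integration of polynomials against an integrable density on `[0, 1]`. -/
noncomputable def densityFunctional (V : ℝ → ℝ) (hV : IntervalIntegrable V volume 0 1) :
    ℝ[X] →ₗ[ℝ] ℝ where
  toFun Q := ∫ x in (0 : ℝ)..1, Q.eval x * V x
  map_add' Q R := by
    rw [← intervalIntegral.integral_add (hV.continuousOn_mul Q.continuous.continuousOn)
      (hV.continuousOn_mul R.continuous.continuousOn)]
    simp [add_mul]
  map_smul' c Q := by
    simp [mul_assoc]

lemma densityFunctional_apply {V : ℝ → ℝ} (hV : IntervalIntegrable V volume 0 1) (Q : ℝ[X]) :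
    densityFunctional V hV Q = ∫ x in (0 : ℝ)..1, Q.eval x * V x := rfl

variable {α β γ t : ℝ}

lemma continuousOn_sub_rpow (ht : t < 0) :
    ContinuousOn (fun x : ℝ => (x - t) ^ γ) (Set.uIcc 0 1) := by
  refine ContinuousOn.rpow_const (by fun_prop) fun x hx => Or.inl ?_
  rw [Set.uIcc_of_le zero_le_one] at hx
  linarith [hx.1]

lemma continuousOn_genJacobiWeight (hα : 0 < α) (hβ : 0 < β) (ht : t < 0) :
    ContinuousOn (genJacobiWeight α β γ t) (Set.uIcc 0 1) :=
  ((continuousOn_sub_rpow ht).mul (continuous_id.rpow_const fun _ => Or.inr hα.le).continuousOn).mul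
    ((continuous_const.sub continuous_id).rpow_const fun _ => Or.inr hβ.le).continuousOn

lemma intervalIntegrable_genJacobiWeight_div_sub (hα : 0 < α) (hβ : 0 < β) (ht : t < 0) :
    IntervalIntegrable (fun x => genJacobiWeight α β γ t x / (x - t)) volume 0 1 := by
  refine ((continuousOn_genJacobiWeight hα hβ ht).div (by fun_prop) fun x hx => ?_).intervalIntegrable
  rw [Set.uIcc_of_le zero_le_one] at hx
  linarith [hx.1]

lemma intervalIntegrable_genJacobiWeight_div (hα : 0 < α) (hβ : 0 < β) (ht : t < 0) :
    IntervalIntegrable (fun x => genJacobiWeight α β γ t x / (x - 0)) volume 0 1 := by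
  have h₁ : IntervalIntegrable (fun x : ℝ => x ^ (α - 1)) volume 0 1 :=
    intervalIntegral.intervalIntegrable_rpow' (by linarith)
  have h₂ := h₁.continuousOn_mul ((continuousOn_sub_rpow (γ := γ) ht).mul
    (((continuous_const (y := (1 : ℝ))).sub continuous_id).rpow_const
      fun _ => Or.inr hβ.le).continuousOn)
  refine h₂.congr fun x hx => ?_
  rw [Set.uIoc_of_le zero_le_one] at hx
  have := hx.1.ne'
  simp only [genJacobiWeight, Pi.mul_apply, Pi.sub_apply, id, rpow_sub_one this, sub_zero]
  ring

lemma intervalIntegrable_genJacobiWeight_div_sub_one (hα : 0 < α) (hβ : 0 < β) (ht : t < 0) :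
    IntervalIntegrable (fun x => genJacobiWeight α β γ t x / (x - 1)) volume 0 1 := by
  have h₀ : IntervalIntegrable (fun x : ℝ => x ^ (β - 1)) volume 0 1 :=
    intervalIntegral.intervalIntegrable_rpow' (by linarith)
  have h₁ : IntervalIntegrable (fun x : ℝ => (1 - x) ^ (β - 1)) volume 0 1 := by
    simpa using (h₀.comp_sub_left 1).symm
  have h₂ := h₁.neg.continuousOn_mul ((continuousOn_sub_rpow (γ := γ) ht).mul
    (continuous_id.rpow_const fun _ => Or.inr hα.le).continuousOn)
  refine h₂.congr_uIoo fun x hx => ?_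
  rw [Set.uIoo_of_le zero_le_one] at hx
  have : 1 - x ≠ 0 := by linarith [hx.2]
  simp only [genJacobiWeight, Pi.mul_apply, Pi.neg_apply, id, rpow_sub_one this]
  rw [← neg_sub 1 x, div_neg]
  ring

/-- Multiplying by `X - c` cancels a factor `1 / (x - c)` in the density. -/
lemma densityFunctional_X_sub_C_mul {W : ℝ → ℝ} {c : ℝ} (hW : IntervalIntegrable W volume 0 1)
    (hV : IntervalIntegrable (fun x => W x / (x - c)) volume 0 1) (Q : ℝ[X]) :
    densityFunctional _ hV ((X - C c) * Q) = densityFunctional W hW Q := by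
  refine intervalIntegral.integral_congr_ae ?_
  filter_upwards [Measure.ae_ne volume c] with x hx _
  have := sub_ne_zero.2 hx
  simp only [eval_mul, eval_sub, eval_X, eval_C]
  field_simp

lemma hasDerivAt_genJacobiWeight (ht : t < 0) {x : ℝ} (hx : x ∈ Set.Ioo (0 : ℝ) 1) :
    HasDerivAt (genJacobiWeight α β γ t) (γ * (genJacobiWeight α β γ t x / (x - t))
      + α * (genJacobiWeight α β γ t x / (x - 0))
      + β * (genJacobiWeight α β γ t x / (x - 1))) x := by
  have hxt : x - t ≠ 0 := by linarith [hx.1]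
  have hx0 : x ≠ 0 := hx.1.ne'
  have hx1 : 1 - x ≠ 0 := by linarith [hx.2]
  have h₁ := ((hasDerivAt_id x).sub_const t).rpow_const (p := γ) (Or.inl hxt)
  have h₂ := (hasDerivAt_id x).rpow_const (p := α) (Or.inl hx0)
  have h₃ := ((hasDerivAt_id x).const_sub 1).rpow_const (p := β) (Or.inl hx1)
  refine ((h₁.mul h₂).mul h₃).congr_deriv ?_
  simp only [genJacobiWeight, Pi.mul_apply, id, rpow_sub_one hxt, rpow_sub_one hx0,
    rpow_sub_one hx1, sub_zero]
  rw [show x - 1 = -(1 - x) by ring]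
  field_simp

/-- The Pearson equation of the generalized Jacobi weight in integrated form. -/
lemma genJacobiWeight_pearson (hα : 0 < α) (hβ : 0 < β) (ht : t < 0)
    (hw : IntervalIntegrable (genJacobiWeight α β γ t) volume 0 1) (Q : ℝ[X]) :
    densityFunctional _ hw (derivative Q)
      + γ * densityFunctional _ (intervalIntegrable_genJacobiWeight_div_sub (γ := γ) hα hβ ht) Q
      + α * densityFunctional _ (intervalIntegrable_genJacobiWeight_div (γ := γ) hα hβ ht) Q
      + β * densityFunctional _ (intervalIntegrable_genJacobiWeight_div_sub_one (γ := γ) hα hβ ht) Q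
      = 0 := by
  have hQ : ContinuousOn (fun x => Q.eval x) (Set.uIcc 0 1) := Q.continuous.continuousOn
  have i := hw.continuousOn_mul (derivative Q).continuous.continuousOn
  have it := ((intervalIntegrable_genJacobiWeight_div_sub (γ := γ) hα hβ ht).continuousOn_mul
    hQ).const_mul γ
  have i₀ := ((intervalIntegrable_genJacobiWeight_div (γ := γ) hα hβ ht).continuousOn_mul
    hQ).const_mul α
  have i₁ := ((intervalIntegrable_genJacobiWeight_div_sub_one (γ := γ) hα hβ ht).continuousOn_mul
    hQ).const_mul β
  simp only [densityFunctional_apply]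
  rw [← intervalIntegral.integral_const_mul, ← intervalIntegral.integral_const_mul,
    ← intervalIntegral.integral_const_mul, ← intervalIntegral.integral_add i it,
    ← intervalIntegral.integral_add (i.add it) i₀,
    ← intervalIntegral.integral_add ((i.add it).add i₀) i₁,
    intervalIntegral.integral_eq_sub_of_hasDerivAt_of_le zero_le_one
      (f := fun x => Q.eval x * genJacobiWeight α β γ t x) ?_ ?_ (((i.add it).add i₀).add i₁)]
  · simp [genJacobiWeight, hα.ne', hβ.ne']
  · rw [← Set.uIcc_of_le zero_le_one]
    exact hQ.mul (continuousOn_genJacobiWeight hα hβ ht)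
  · intro x hx
    refine ((Q.hasDerivAt x).mul (hasDerivAt_genJacobiWeight ht hx)).congr_deriv ?_
    ring

end Weight

theorem statement14
    (α β γ t : ℝ) (hα : 0 < α) (hβ : 0 < β) (ht : t < 0)
    (P : ℕ → Polynomial ℝ) (h : ℕ → ℝ)
    (hmonic : ∀ n, (P n).Monic ∧ (P n).natDegree = n)
    (hpos : ∀ n, 0 < h n)
    (horth : ∀ m n, (∫ x in (0:ℝ)..1,
        (P m).eval x * (P n).eval x * genJacobiWeight α β γ t x)
      = if m = n then h n else 0)
    (a b : ℕ → ℝ) (hb0 : b 0 = 0)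
    (hrec : ∀ n, ∀ x : ℝ, x * (P n).eval x
      = (P (n + 1)).eval x + a n * (P n).eval x + b n * (P (n - 1)).eval x)
    (r rs : ℕ → ℝ)
    (hr : ∀ n, 1 ≤ n → r n = β / h (n - 1) *
      ∫ y in (0:ℝ)..1, (P (n - 1)).eval y * (P n).eval y * genJacobiWeight α β γ t y / (1 - y))
    (hrs : ∀ n, 1 ≤ n → rs n = α / h (n - 1) *
      ∫ y in (0:ℝ)..1, (P (n - 1)).eval y * (P n).eval y * genJacobiWeight α β γ t y / y)
    :
    ∀ n : ℕ, 1 ≤ n →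
      (2 * n - 1 + α + β + γ) * (2 * n + 1 + α + β + γ) * b n
        = (t * rs n - (t - 1) * r n) ^ 2
          - (t - 1) * (2 * n * t + γ * t + β) * r n
          + t * ((t - 1) * (2 * n + γ) - α) * rs n
          + n * (n + γ) * (t ^ 2 - t) := by
  intro n hn
  obtain ⟨k, rfl⟩ : ∃ k, n = k + 1 := ⟨n - 1, by omega⟩
  have hw := (continuousOn_genJacobiWeight (γ := γ) hα hβ ht).intervalIntegrable
    (μ := volume)
  have hrec' : X * P (k + 1) = P (k + 2) + C (a (k + 1)) * P (k + 1) + C (b (k + 1)) * P k :=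
    Polynomial.funext fun x => by simpa using hrec (k + 1) x
  push_cast
  refine recurrence_coeff_of_pearson (L := densityFunctional _ hw) hmonic
    (fun m n => ?_) hpos (densityFunctional_X_sub_C_mul hw _)
    (densityFunctional_X_sub_C_mul hw _) (densityFunctional_X_sub_C_mul hw _)
    (genJacobiWeight_pearson hα hβ ht hw) hrec' ?_ ?_
  · rw [densityFunctional_apply]
    simpa using horth m n
  · rw [hr (k + 1) hn, densityFunctional_apply, ← mul_neg, ← intervalIntegral.integral_neg]
    congr 1
    refine intervalIntegral.integral_congr fun x _ => ?_
    simp only [eval_mul, Nat.add_sub_cancel]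
    rw [← neg_sub x 1, div_neg, mul_div_assoc]
  · rw [hrs (k + 1) hn, densityFunctional_apply]
    simp [mul_div_assoc]
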